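/- arXiv:2603.25679 — 3 statements merged into one kernel-verified Lean document; each statement's English description precedes it below -/
import Mathlib

section
/- If R is a left (n,d)-coherent ring, then FP_n^{≤d}(R) equals the class of finitely ∞-presented R-modules of flat dimension at most d, i.e., FP_n^{≤d}(R) = FP_∞(R) ∩ F^{≤d}(R). -/
universe u

/-- `M` is a finitely `n`-presented `R`-module. -/
def FinNPres (R : Type u) [Ring R] : ℕ → (M : Type u) → [AddCommGroup M] → [Module R M] → Prop
  | 0, M, _, _ => Module.Finite R M
  | n+1, M, _, _ => ∃ (k : ℕ) (f : (Fin k → R) →ₗ[R] M), Function.Surjective f ∧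
      FinNPres R n (LinearMap.ker f)

/-- `M` has projective dimension at most `d` (finite `d`). -/
def ProjDimLE (R : Type u) [Ring R] : ℕ → (M : Type u) → [AddCommGroup M] → [Module R M] → Prop
  | 0, M, _, _ => Module.Projective R M
  | d+1, M, _, _ => ∃ (ι : Type u) (f : (ι →₀ R) →ₗ[R] M), Function.Surjective f ∧
      ProjDimLE R d (LinearMap.ker f)

/-- Projective dimension at most `d` for `d : ℕ∞`; `d = ⊤` imposes no condition. -/
def ProjDimLE' (R : Type u) [Ring R] (d : ℕ∞) (M : Type u) [AddCommGroup M] [Module R M] : Prop :=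
  ∀ k : ℕ, (k : ℕ∞) = d → ProjDimLE R k M

/-- `R` is a left `(n,d)`-coherent ring: every finitely `n`-presented left `R`-module of
projective dimension at most `d` is finitely `(n+1)`-presented. -/
def NDCohRing (R : Type u) [Ring R] (n : ℕ) (d : ℕ∞) : Prop :=
  ∀ (M : Type u) [AddCommGroup M] [Module R M],
    FinNPres R n M → ProjDimLE' R d M → FinNPres R (n + 1) M

open TensorProduct in
/-- The subgroup of `A ⊗[ℤ] K` generated by the middle-linearity relations for the right
`R`-module `A` and the left `R`-module `K`. -/
noncomputable def brel (R : Type u) [Ring R] (A K : Type u) [AddCommGroup A] [Module Rᵐᵒᵖ A]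
    [AddCommGroup K] [Module R K] : AddSubgroup (A ⊗[ℤ] K) :=
  AddSubgroup.closure {x | ∃ (a : A) (r : R) (k : K),
    x = (MulOpposite.op r • a) ⊗ₜ[ℤ] k - a ⊗ₜ[ℤ] (r • k)}

open TensorProduct in
/-- The balanced tensor product `A ⊗[R] K` of a right `R`-module `A` and a left
`R`-module `K`, realized as a quotient of `A ⊗[ℤ] K`. -/
def BTen (R : Type u) [Ring R] (A K : Type u) [AddCommGroup A] [Module Rᵐᵒᵖ A]
    [AddCommGroup K] [Module R K] : Type u :=
  (A ⊗[ℤ] K) ⧸ brel R A K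

noncomputable instance (R : Type u) [Ring R] (A K : Type u) [AddCommGroup A] [Module Rᵐᵒᵖ A]
    [AddCommGroup K] [Module R K] : AddCommGroup (BTen R A K) :=
  QuotientAddGroup.Quotient.addCommGroup _

/-- Functoriality of the balanced tensor product in the right-module variable. -/
noncomputable def BTen.mapLeft (R : Type u) [Ring R] {A B : Type u} (K : Type u) [AddCommGroup A]
    [Module Rᵐᵒᵖ A] [AddCommGroup B] [Module Rᵐᵒᵖ B] [AddCommGroup K] [Module R K]
    (f : A →ₗ[Rᵐᵒᵖ] B) : BTen R A K →+ BTen R B K :=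
  QuotientAddGroup.map _ _
    (TensorProduct.map f.toAddMonoidHom.toIntLinearMap LinearMap.id).toAddMonoidHom
    (by
      refine (AddSubgroup.closure_le _).2 ?_
      rintro x ⟨a, r, k, rfl⟩
      simp only [SetLike.mem_coe, AddSubgroup.mem_comap, LinearMap.toAddMonoidHom_coe,
        map_sub, TensorProduct.map_tmul, AddMonoidHom.coe_toIntLinearMap,
        LinearMap.toAddMonoidHom_coe, LinearMap.id_coe, id_eq, LinearMap.map_smul]
      exact AddSubgroup.subset_closure ⟨f a, r, k, rfl⟩)

/-- The left `R`-module `K` is flat: tensoring with `K` preserves injections of right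
`R`-modules. -/
def FlatMod (R : Type u) [Ring R] (K : Type u) [AddCommGroup K] [Module R K] : Prop :=
  ∀ (A B : Type u) [AddCommGroup A] [Module Rᵐᵒᵖ A] [AddCommGroup B] [Module Rᵐᵒᵖ B]
    (f : A →ₗ[Rᵐᵒᵖ] B), Function.Injective f → Function.Injective (BTen.mapLeft R K f)

/-- Flat dimension at most `d` (finite `d`). -/
def FlatDimLE (R : Type u) [Ring R] : ℕ → (M : Type u) → [AddCommGroup M] → [Module R M] → Prop
  | 0, M, _, _ => FlatMod R M
  | d+1, M, _, _ => ∃ (ι : Type u) (f : (ι →₀ R) →ₗ[R] M), Function.Surjective f ∧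
      FlatDimLE R d (LinearMap.ker f)

/-- Flat dimension at most `d` for `d : ℕ∞`; `d = ⊤` imposes no condition. -/
def FlatDimLE' (R : Type u) [Ring R] (d : ℕ∞) (M : Type u) [AddCommGroup M] [Module R M] : Prop :=
  ∀ k : ℕ, (k : ℕ∞) = d → FlatDimLE R k M

section Generic

variable {R : Type u} [Ring R]

/-- Generic resolution dimension with respect to a class `C`. -/
def GDim (R : Type u) [Ring R] (C : ∀ (M : Type u) [AddCommGroup M] [Module R M], Prop) :
    ℕ → (M : Type u) → [AddCommGroup M] → [Module R M] → Prop
  | 0, M, _, _ => C M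
  | d+1, M, _, _ => ∃ (ι : Type u) (f : (ι →₀ R) →ₗ[R] M), Function.Surjective f ∧
      GDim R C d (LinearMap.ker f)

theorem projDimLE_iff (d : ℕ) : ∀ (M : Type u) [AddCommGroup M] [Module R M],
    ProjDimLE R d M ↔ GDim R (fun M _ _ => Module.Projective R M) d M := by
  induction d with
  | zero => intro M _ _; exact Iff.rfl
  | succ d ih =>
    intro M _ _
    simp only [ProjDimLE, GDim, ih]

theorem flatDimLE_iff (d : ℕ) : ∀ (M : Type u) [AddCommGroup M] [Module R M],
    FlatDimLE R d M ↔ GDim R (fun M _ _ => FlatMod R M) d M := by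
  induction d with
  | zero => intro M _ _; exact Iff.rfl
  | succ d ih =>
    intro M _ _
    simp only [FlatDimLE, GDim, ih]

/-- Closure properties of a class of modules. -/
structure GoodClass (C : ∀ (M : Type u) [AddCommGroup M] [Module R M], Prop) : Prop where
  retract : ∀ (M N : Type u) [AddCommGroup M] [Module R M] [AddCommGroup N] [Module R N]
    (i : M →ₗ[R] N) (p : N →ₗ[R] M), (∀ x, p (i x) = x) → C N → C M
  addFree : ∀ (M : Type u) [AddCommGroup M] [Module R M] (ι : Type u), C M → C (M × (ι →₀ R))

variable {C : ∀ (M : Type u) [AddCommGroup M] [Module R M], Prop}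

theorem GDim.iso (hC : GoodClass C) (d : ℕ) : ∀ (M N : Type u) [AddCommGroup M] [Module R M]
    [AddCommGroup N] [Module R N] (_ : M ≃ₗ[R] N), GDim R C d M → GDim R C d N := by
  induction d with
  | zero =>
    intro M N _ _ _ _ e h
    exact hC.retract N M e.symm.toLinearMap e.toLinearMap (by simp) h
  | succ d ih =>
    rintro M N _ _ _ _ e ⟨ι, f, hf, hk⟩
    refine ⟨ι, e.toLinearMap ∘ₗ f, e.surjective.comp hf, ?_⟩
    exact ih _ _ (LinearEquiv.ofEq _ _ (LinearEquiv.ker_comp e f).symm) hk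

/-- Precomposing with an equivalence does not change the kernel up to isomorphism. -/
noncomputable def kerCompEquiv {P Q M : Type u} [AddCommGroup P] [Module R P] [AddCommGroup Q]
    [Module R Q] [AddCommGroup M] [Module R M] (e : P ≃ₗ[R] Q) (f : Q →ₗ[R] M) :
    LinearMap.ker (f ∘ₗ e.toLinearMap) ≃ₗ[R] LinearMap.ker f :=
  LinearEquiv.ofBijective
    ((e.toLinearMap.comp (LinearMap.ker (f ∘ₗ e.toLinearMap)).subtype).codRestrict _
      (fun x => x.2))
    ⟨fun x y h => by
      have := congrArg Subtype.val h
      exact Subtype.ext (e.injective this),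
    fun y => ⟨⟨e.symm y, by simp⟩, Subtype.ext (e.apply_symm_apply y)⟩⟩

theorem GDim.addFree (hC : GoodClass C) (d : ℕ) : ∀ (M : Type u) [AddCommGroup M] [Module R M]
    (ι : Type u), GDim R C d M → GDim R C d (M × (ι →₀ R)) := by
  cases d with
  | zero => exact hC.addFree
  | succ d =>
    rintro M _ _ ι ⟨κ, f, hf, hk⟩
    let e := Finsupp.sumFinsuppLEquivProdFinsupp R (α := κ) (β := ι) (M := R)
    let F : ((κ →₀ R) × (ι →₀ R)) →ₗ[R] (M × (ι →₀ R)) := f.prodMap LinearMap.id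
    refine ⟨κ ⊕ ι, F ∘ₗ e.toLinearMap, ?_, ?_⟩
    · have hF : Function.Surjective F := by
        rintro ⟨m, v⟩
        obtain ⟨a, rfl⟩ := hf m
        exact ⟨(a, v), rfl⟩
      exact hF.comp e.surjective
    · refine GDim.iso hC d (LinearMap.ker F) _ (kerCompEquiv e F).symm ?_
      refine GDim.iso hC d _ _ (LinearEquiv.ofBijective
        (((LinearMap.inl R (κ →₀ R) (ι →₀ R)).comp (LinearMap.ker f).subtype).codRestrict
          (LinearMap.ker F) (fun x => by simp [F])) ⟨?_, ?_⟩) hk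
      · intro x y h
        have := congrArg (fun z => z.1.1) h
        exact Subtype.ext this
      · rintro ⟨⟨a, b⟩, h⟩
        have h1 : f a = 0 := congrArg Prod.fst h
        have h2 : b = 0 := congrArg Prod.snd h
        subst h2
        exact ⟨⟨a, h1⟩, rfl⟩

theorem GDim.removeFree (hC : GoodClass C) (d : ℕ) (M : Type u) [AddCommGroup M] [Module R M]
    (ι : Type u) (h : GDim R C d (M × (ι →₀ R))) : GDim R C d M := by
  cases d with
  | zero =>
    exact hC.retract M _ (LinearMap.inl R _ _) (LinearMap.fst R _ _) (by simp) h
  | succ d =>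
    obtain ⟨κ, h, hs, hk⟩ := h
    obtain ⟨s, hs'⟩ := Module.projective_lifting_property h (LinearMap.inr R M (ι →₀ R)) hs
    have hsv : ∀ v, h (s v) = (0, v) := fun v => LinearMap.congr_fun hs' v
    refine ⟨κ, LinearMap.fst R _ _ ∘ₗ h, Prod.fst_surjective.comp hs, ?_⟩
    have h1 := GDim.addFree hC d _ ι hk
    refine GDim.iso hC d _ _ (LinearEquiv.ofBijective
      (((LinearMap.ker h).subtype.coprod s).codRestrict
        (LinearMap.ker (LinearMap.fst R M (ι →₀ R) ∘ₗ h)) ?_) ⟨?_, ?_⟩) h1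
    · rintro ⟨⟨x, hx⟩, v⟩
      have hx : h x = 0 := hx
      simp [hx, hsv]
    · refine (injective_iff_map_eq_zero _).2 ?_
      rintro ⟨⟨x, hx⟩, v⟩ h0
      have hx' : h x = 0 := hx
      have h0 : x + s v = 0 := congrArg Subtype.val h0
      have h2 := congrArg h h0
      rw [map_add, hx', hsv, map_zero, zero_add] at h2
      have hv : v = 0 := congrArg Prod.snd h2
      subst hv
      have : x = 0 := by simpa using h0
      subst this
      rfl
    · rintro ⟨x, hx⟩
      have hx' : (h x).1 = 0 := hx
      refine ⟨(⟨x - s (h x).2, ?_⟩, (h x).2), Subtype.ext ?_⟩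
      · rw [LinearMap.mem_ker, map_sub, hsv]
        ext1 <;> simp [hx']
      · simp

/-- Half of Schanuel's lemma. -/
theorem half_schanuel {P F M : Type u} [AddCommGroup P] [Module R P] [AddCommGroup F]
    [Module R F] [AddCommGroup M] [Module R M] [Module.Projective R F] (f : P →ₗ[R] M)
    (hf : Function.Surjective f) (g : F →ₗ[R] M) :
    Nonempty ((LinearMap.ker f × F) ≃ₗ[R] LinearMap.ker (f.coprod g)) := by
  obtain ⟨s, hs'⟩ := Module.projective_lifting_property f g hf
  have hsv : ∀ v, f (s v) = g v := fun v => LinearMap.congr_fun hs' v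
  refine ⟨LinearEquiv.ofBijective
    ((LinearMap.prod ((LinearMap.ker f).subtype.coprod (-s)) (LinearMap.snd R _ _)).codRestrict
      (LinearMap.ker (f.coprod g)) ?_) ⟨?_, ?_⟩⟩
  · rintro ⟨⟨x, hx⟩, v⟩
    have hx : f x = 0 := hx
    simp [hx, hsv]
  · refine (injective_iff_map_eq_zero _).2 ?_
    rintro ⟨⟨x, hx⟩, v⟩ h0
    have h0 : ((x + (-s) v, v) : P × F) = 0 := congrArg Subtype.val h0
    have hv : v = 0 := congrArg Prod.snd h0
    subst hv
    have : x = 0 := by simpa using h0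
    subst this
    rfl
  · rintro ⟨⟨x, v⟩, hx⟩
    have hx' : f x + g v = 0 := by simpa using hx
    refine ⟨(⟨x + s v, ?_⟩, v), Subtype.ext ?_⟩
    · rw [LinearMap.mem_ker, map_add, hsv, hx']
    · simp

theorem GDim.syzygy (hC : GoodClass C) (d : ℕ) (M : Type u) [AddCommGroup M] [Module R M]
    (h : GDim R C (d+1) M) (κ : Type u) (P : Type u) [AddCommGroup P] [Module R P]
    (E : (κ →₀ R) ≃ₗ[R] P) (g : P →ₗ[R] M) (hg : Function.Surjective g) :
    GDim R C d (LinearMap.ker g) := by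
  obtain ⟨ι, f, hf, hk⟩ := h
  let g' := g ∘ₗ E.toLinearMap
  have hg' : Function.Surjective g' := hg.comp E.surjective
  obtain ⟨e1⟩ := half_schanuel f hf g'
  obtain ⟨e2⟩ := half_schanuel g' hg' f
  let sw : LinearMap.ker (f.coprod g') ≃ₗ[R] LinearMap.ker (g'.coprod f) :=
    (LinearEquiv.ofEq _ _ (by
      congr 1
      ext x <;> simp)).trans (kerCompEquiv (LinearEquiv.prodComm R (ι →₀ R) (κ →₀ R)) (g'.coprod f))
  have h1 := GDim.addFree hC d _ κ hk
  have h2 := GDim.iso hC d _ (LinearMap.ker g' × (ι →₀ R)) ((e1.trans sw).trans e2.symm) h1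
  have h3 := GDim.removeFree hC d _ ι h2
  exact GDim.iso hC d _ _ (kerCompEquiv E g) h3

theorem GDim.cover (hC : GoodClass C) (d : ℕ) (M : Type u) [AddCommGroup M] [Module R M]
    (κ : Type u) (P : Type u) [AddCommGroup P] [Module R P]
    (E : (κ →₀ R) ≃ₗ[R] P) (g : P →ₗ[R] M) (hg : Function.Surjective g)
    (h : GDim R C d (LinearMap.ker g)) : GDim R C (d+1) M :=
  ⟨κ, g ∘ₗ E.toLinearMap, hg.comp E.surjective, GDim.iso hC d _ _ (kerCompEquiv E g).symm h⟩

/-- The finite free module in the two guises. -/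
noncomputable def finFree (R : Type u) [Ring R] (k : ℕ) :
    (ULift.{u} (Fin k) →₀ R) ≃ₗ[R] (Fin k → R) :=
  (Finsupp.domLCongr Equiv.ulift).trans (Finsupp.linearEquivFunOnFinite R R (Fin k))

theorem goodProj : GoodClass (R := R) (fun M _ _ => Module.Projective R M) where
  retract := fun M N _ _ _ _ i p h hN =>
    haveI := hN
    Module.Projective.of_split i p (LinearMap.ext h)
  addFree := fun M _ _ ι h => by
    haveI := h
    infer_instance

theorem projDim_succ (d : ℕ) : ∀ (M : Type u) [AddCommGroup M] [Module R M],
    GDim R (fun M _ _ => Module.Projective R M) d M →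
    GDim R (fun M _ _ => Module.Projective R M) (d+1) M := by
  induction d with
  | zero =>
    intro M _ _ h
    have h : Module.Projective R M := h
    have hs : Function.Surjective (Finsupp.linearCombination R (id : M → M)) :=
      Finsupp.linearCombination_id_surjective R M
    refine ⟨M, Finsupp.linearCombination R id, hs, ?_⟩
    obtain ⟨s, hs'⟩ := Module.projective_lifting_property
      (Finsupp.linearCombination R (id : M → M)) LinearMap.id hs
    have hsv : ∀ v, Finsupp.linearCombination R (id : M → M) (s v) = v :=
      fun v => LinearMap.congr_fun hs' v
    refine goodProj.retract _ (M →₀ R) (Submodule.subtype _)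
      ((LinearMap.id - s ∘ₗ Finsupp.linearCombination R (id : M → M)).codRestrict _ ?_) ?_
      inferInstance
    · rintro ⟨x, hx⟩
      apply Subtype.ext
      rw [LinearMap.mem_ker] at hx
      change x - s (Finsupp.linearCombination R (id : M → M) x) = x
      rw [hx, map_zero, sub_zero]
    · intro c
      rw [LinearMap.mem_ker]
      simp only [LinearMap.sub_apply, LinearMap.id_apply, LinearMap.comp_apply, map_sub, hsv,
        sub_self]
  | succ d ih =>
    rintro M _ _ ⟨ι, f, hf, hk⟩
    exact ⟨ι, f, hf, ih _ hk⟩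

end Generic

section Balanced

variable {R : Type u} [Ring R]

open TensorProduct

/-- Pure tensors in the balanced tensor product. -/
noncomputable def BTen.mk (R : Type u) [Ring R] {A K : Type u} [AddCommGroup A] [Module Rᵐᵒᵖ A]
    [AddCommGroup K] [Module R K] (a : A) (k : K) : BTen R A K :=
  QuotientAddGroup.mk' (brel R A K) (a ⊗ₜ[ℤ] k)

variable {A B K L : Type u} [AddCommGroup A] [Module Rᵐᵒᵖ A] [AddCommGroup B] [Module Rᵐᵒᵖ B]
  [AddCommGroup K] [Module R K] [AddCommGroup L] [Module R L]

theorem BTen.mk_add (a : A) (k l : K) : BTen.mk R a (k + l) = BTen.mk R a k + BTen.mk R a l := by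
  unfold BTen.mk
  rw [TensorProduct.tmul_add]
  exact map_add (QuotientAddGroup.mk' (brel R A K)) _ _

theorem BTen.add_mk (a b : A) (k : K) : BTen.mk R (a + b) k = BTen.mk R a k + BTen.mk R b k := by
  unfold BTen.mk
  rw [TensorProduct.add_tmul]
  exact map_add (QuotientAddGroup.mk' (brel R A K)) _ _

theorem BTen.smul_mk (a : A) (r : R) (k : K) :
    BTen.mk R (MulOpposite.op r • a) k = BTen.mk R a (r • k) := by
  have : QuotientAddGroup.mk' (brel R A K)
      ((MulOpposite.op r • a) ⊗ₜ[ℤ] k - a ⊗ₜ[ℤ] (r • k)) = 0 :=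
    (QuotientAddGroup.eq_zero_iff _).2 (AddSubgroup.subset_closure ⟨a, r, k, rfl⟩)
  rw [map_sub] at this
  exact sub_eq_zero.1 this

/-- Pure tensors, as a biadditive map. -/
noncomputable def BTen.mkHom (R : Type u) [Ring R] (A K : Type u) [AddCommGroup A]
    [Module Rᵐᵒᵖ A] [AddCommGroup K] [Module R K] : A →+ K →+ BTen R A K :=
  AddMonoidHom.mk' (fun a => AddMonoidHom.mk' (fun k => BTen.mk R a k) (BTen.mk_add a))
    (fun a b => by ext k; exact BTen.add_mk a b k)

/-- Universal property. -/
noncomputable def BTen.lift {G : Type u} [AddCommGroup G] (φ : A →+ K →+ G)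
    (h : ∀ a (r : R) k, φ (MulOpposite.op r • a) k = φ a (r • k)) : BTen R A K →+ G :=
  QuotientAddGroup.lift (brel R A K)
    (TensorProduct.liftAddHom φ (fun r m n => by simp))
    (by
      refine (AddSubgroup.closure_le _).2 ?_
      rintro x ⟨a, r, k, rfl⟩
      simp [h])

theorem BTen.lift_mk {G : Type u} [AddCommGroup G] (φ : A →+ K →+ G)
    (h : ∀ a (r : R) k, φ (MulOpposite.op r • a) k = φ a (r • k)) (a : A) (k : K) :
    BTen.lift φ h (BTen.mk R a k) = φ a k := rfl

theorem BTen.mapLeft_mk (f : A →ₗ[Rᵐᵒᵖ] B) (a : A) (k : K) :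
    BTen.mapLeft R K f (BTen.mk R a k) = BTen.mk R (f a) k := rfl

theorem BTen.ind {p : BTen R A K → Prop} (x : BTen R A K) (h0 : p 0)
    (hadd : ∀ x y, p x → p y → p (x + y)) (hmk : ∀ a k, p (BTen.mk R a k)) : p x := by
  obtain ⟨y, rfl⟩ := QuotientAddGroup.mk'_surjective (brel R A K) x
  induction y with
  | zero => exact h0
  | tmul a k => exact hmk a k
  | add x y hx hy =>
    have := hadd _ _ hx hy
    exact this

theorem BTen.hom_ext {G : Type u} [AddCommGroup G] {φ ψ : BTen R A K →+ G}
    (h : ∀ a k, φ (BTen.mk R a k) = ψ (BTen.mk R a k)) (x : BTen R A K) : φ x = ψ x := by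
  refine BTen.ind (p := fun x => φ x = ψ x) x ?_ ?_ h
  · simp
  · intro x y hx hy
    simp only [map_add, hx, hy]

/-- Functoriality in the left-module variable. -/
noncomputable def BTen.mapRight (A : Type u) [AddCommGroup A] [Module Rᵐᵒᵖ A] (g : K →ₗ[R] L) :
    BTen R A K →+ BTen R A L :=
  BTen.lift (AddMonoidHom.mk' (fun a => ((BTen.mkHom R A L) a).comp g.toAddMonoidHom)
    (fun a b => by ext k; simp))
    (fun a r k => by
      change BTen.mk R _ (g k) = BTen.mk R a (g (r • k))
      rw [map_smul, BTen.smul_mk])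

theorem BTen.mapRight_mk (g : K →ₗ[R] L) (a : A) (k : K) :
    BTen.mapRight A g (BTen.mk R a k) = BTen.mk R a (g k) := rfl

theorem BTen.natural (f : A →ₗ[Rᵐᵒᵖ] B) (g : K →ₗ[R] L) (x : BTen R A K) :
    BTen.mapLeft R L f (BTen.mapRight A g x) = BTen.mapRight B g (BTen.mapLeft R K f x) :=
  BTen.hom_ext (φ := (BTen.mapLeft R L f).comp (BTen.mapRight A g))
    (ψ := (BTen.mapRight B g).comp (BTen.mapLeft R K f)) (fun a k => rfl) x

theorem flat_retract (i : K →ₗ[R] L) (p : L →ₗ[R] K) (h : ∀ x, p (i x) = x)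
    (hL : FlatMod R L) : FlatMod R K := by
  intro A B _ _ _ _ f hf
  have key : ∀ x, BTen.mapRight A p (BTen.mapRight A i x) = x := fun x =>
    BTen.hom_ext (φ := (BTen.mapRight A p).comp (BTen.mapRight A i)) (ψ := AddMonoidHom.id _)
      (fun a k => by
        change BTen.mk R a (p (i k)) = BTen.mk R a k
        rw [h]) x
  intro x y hxy
  rw [← key x, ← key y]
  congr 1
  apply hL A B f hf
  rw [BTen.natural, BTen.natural, hxy]

theorem flat_prod (hK : FlatMod R K) (hL : FlatMod R L) : FlatMod R (K × L) := by
  intro A B _ _ _ _ f hf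
  have key : ∀ x : BTen R A (K × L),
      BTen.mapRight A (LinearMap.inl R K L) (BTen.mapRight A (LinearMap.fst R K L) x) +
      BTen.mapRight A (LinearMap.inr R K L) (BTen.mapRight A (LinearMap.snd R K L) x) = x :=
    fun x => BTen.hom_ext
      (φ := (BTen.mapRight A (LinearMap.inl R K L)).comp (BTen.mapRight A (LinearMap.fst R K L)) +
        (BTen.mapRight A (LinearMap.inr R K L)).comp (BTen.mapRight A (LinearMap.snd R K L)))
      (ψ := AddMonoidHom.id _)
      (fun a k => by
        change BTen.mk R a (k.1, 0) + BTen.mk R a (0, k.2) = BTen.mk R a k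
        rw [← BTen.mk_add]
        simp) x
  intro x y hxy
  rw [← key x, ← key y]
  have h1 : BTen.mapRight A (LinearMap.fst R K L) x = BTen.mapRight A (LinearMap.fst R K L) y := by
    apply hK A B f hf
    rw [BTen.natural, BTen.natural, hxy]
  have h2 : BTen.mapRight A (LinearMap.snd R K L) x = BTen.mapRight A (LinearMap.snd R K L) y := by
    apply hL A B f hf
    rw [BTen.natural, BTen.natural, hxy]
  rw [h1, h2]

/-- The map `A ⊗ R^(ι) → A^(ι)`. -/
noncomputable def freeMap (A : Type u) [AddCommGroup A] [Module Rᵐᵒᵖ A] (ι : Type u) :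
    BTen R A (ι →₀ R) →+ (ι →₀ A) :=
  BTen.lift (AddMonoidHom.mk' (fun a => AddMonoidHom.mk'
      (fun v => v.mapRange (fun r => MulOpposite.op r • a) (by simp))
      (fun v w => by ext i; simp [add_smul]))
    (fun a b => by ext v i; simp))
    (fun a r v => by ext i; simp [mul_smul])

theorem freeMap_mk (ι : Type u) (a : A) (v : ι →₀ R) :
    freeMap A ι (BTen.mk R a v) = v.mapRange (fun r => MulOpposite.op r • a) (by simp) := rfl

theorem freeMap_inj (ι : Type u) : Function.Injective (freeMap (R := R) A ι) := by
  let ψ : (ι →₀ A) →+ BTen R A (ι →₀ R) :=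
    Finsupp.liftAddHom (fun i => (BTen.mkHom R A (ι →₀ R)).flip (Finsupp.single i 1))
  have key : ∀ x, ψ (freeMap A ι x) = x := fun x =>
    BTen.hom_ext (φ := ψ.comp (freeMap A ι)) (ψ := AddMonoidHom.id _) (fun a v => by
      change ψ (v.mapRange (fun r => MulOpposite.op r • a) (by simp)) = BTen.mkHom R A _ a v
      induction v using Finsupp.induction_linear with
      | zero => simp
      | add v w hv hw =>
        rw [map_add, ← hv, ← hw, ← map_add]
        congr 1
        ext i
        simp [add_smul]
      | single i r =>
        rw [Finsupp.mapRange_single]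
        simp only [ψ, Finsupp.liftAddHom_apply_single]
        change BTen.mk R (MulOpposite.op r • a) (Finsupp.single i 1) = BTen.mk R a _
        rw [BTen.smul_mk]
        simp) x
  exact Function.LeftInverse.injective key

theorem flat_free (ι : Type u) : FlatMod R (ι →₀ R) := by
  intro A B _ _ _ _ f hf
  have nat : ∀ x, freeMap B ι (BTen.mapLeft R (ι →₀ R) f x) =
      Finsupp.mapRange.addMonoidHom f.toAddMonoidHom (freeMap A ι x) := fun x =>
    BTen.hom_ext (φ := (freeMap B ι).comp (BTen.mapLeft R (ι →₀ R) f))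
      (ψ := (Finsupp.mapRange.addMonoidHom f.toAddMonoidHom).comp (freeMap A ι))
      (fun a v => by
        ext i
        simp [BTen.mapLeft_mk, freeMap_mk]) x
  intro x y hxy
  apply freeMap_inj
  have h := (nat x).symm.trans ((congrArg _ hxy).trans (nat y))
  exact Finsupp.mapRange_injective _ (map_zero f) hf h

theorem goodFlat : GoodClass (R := R) (fun M _ _ => FlatMod R M) where
  retract := fun _ _ _ _ _ _ i p h hN => flat_retract i p h hN
  addFree := fun _ _ _ ι h => flat_prod h (flat_free ι)

theorem flat_of_projective (h : Module.Projective R K) : FlatMod R K := by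
  obtain ⟨s, hs⟩ := h.out
  exact flat_retract s (Finsupp.linearCombination R id) hs (flat_free K)

theorem flatDim_of_projDim (d : ℕ) : ∀ (M : Type u) [AddCommGroup M] [Module R M],
    ProjDimLE R d M → FlatDimLE R d M := by
  induction d with
  | zero => intro M _ _ h; exact flat_of_projective h
  | succ d ih =>
    rintro M _ _ ⟨ι, f, hf, hk⟩
    exact ⟨ι, f, hf, ih _ hk⟩

end Balanced

section Equational

variable {R : Type u} [Ring R]

open TensorProduct

theorem flat_equational {M : Type u} [AddCommGroup M] [Module R M] (hM : FlatMod R M)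
    {κ : Type} [Fintype κ] [DecidableEq κ] (r : κ → R) (x : κ → M) (hrx : ∑ i, r i • x i = 0) :
    ∃ (ι : Type) (_ : Fintype ι) (a : κ → ι → R) (y : ι → M),
      (∀ j, ∑ i, r i * a i j = 0) ∧ ∀ i, x i = ∑ j, a i j • y j := by
  let φ : (κ → R) →ₗ[Rᵐᵒᵖ] R :=
    { toFun := fun a => ∑ i, r i * a i
      map_add' := fun a b => by simp [mul_add, Finset.sum_add_distrib]
      map_smul' := fun s a => by simp [Finset.sum_mul, mul_assoc] }
  let N := LinearMap.ker φ
  let S : AddSubgroup (κ → M) :=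
    AddSubgroup.closure {z | ∃ (a : κ → R) (m : M), φ a = 0 ∧ z = fun i => a i • m}
  have hS : x ∈ S := by
    let φ' : ((κ → R) ⧸ N) →ₗ[Rᵐᵒᵖ] R := N.liftQ φ le_rfl
    have hφ' : Function.Injective φ' :=
      LinearMap.ker_eq_bot.1 (Submodule.ker_liftQ_eq_bot _ _ _ le_rfl)
    -- the map to `M^κ / S`
    let β0 : (κ → R) →+ M →+ ((κ → M) ⧸ S) :=
      AddMonoidHom.mk' (fun a => AddMonoidHom.mk'
        (fun m => QuotientAddGroup.mk' S (fun i => a i • m))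
        (fun m m' => by
          rw [← map_add]; congr 1; ext i; simp))
        (fun a b => by
          ext m
          change QuotientAddGroup.mk' S _ = QuotientAddGroup.mk' S _ + QuotientAddGroup.mk' S _
          rw [← map_add]; congr 1; ext i; simp [add_smul])
    let β : ((κ → R) ⧸ N) →+ M →+ ((κ → M) ⧸ S) :=
      QuotientAddGroup.lift N.toAddSubgroup β0 (by
        intro a ha
        ext m
        exact (QuotientAddGroup.eq_zero_iff _).2 (AddSubgroup.subset_closure ⟨a, m, ha, rfl⟩))
    have hβ : ∀ a m, β (Submodule.Quotient.mk a) m =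
      QuotientAddGroup.mk' S (fun i => a i • m) := fun a m => rfl
    let Φ : BTen R ((κ → R) ⧸ N) M →+ ((κ → M) ⧸ S) := BTen.lift β (by
      intro a s m
      obtain ⟨a, rfl⟩ := Submodule.Quotient.mk_surjective _ a
      rw [← Submodule.Quotient.mk_smul, hβ, hβ]
      congr 1
      ext i
      simp [mul_smul])
    let t : BTen R ((κ → R) ⧸ N) M :=
      ∑ i, BTen.mk R (Submodule.Quotient.mk (Pi.single i 1)) (x i)
    have ht : t = 0 := by
      apply hM _ _ φ' hφ'
      rw [map_zero, map_sum]
      have : ∀ i, BTen.mapLeft R M φ' (BTen.mk R (Submodule.Quotient.mk (Pi.single i 1)) (x i))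
          = BTen.mkHom R R M 1 (r i • x i) := by
        intro i
        change BTen.mk R (φ (Pi.single i 1)) (x i) = BTen.mk R 1 (r i • x i)
        rw [← BTen.smul_mk]
        congr 1
        simp [φ, Pi.single_apply]
      rw [Finset.sum_congr rfl (fun i _ => this i), ← map_sum, hrx, map_zero]
    have hΦ : Φ t = QuotientAddGroup.mk' S x := by
      have : ∀ i, Φ (BTen.mk R (Submodule.Quotient.mk (Pi.single i 1)) (x i)) =
          QuotientAddGroup.mk' S (fun j => (Pi.single i (1 : R) : κ → R) j • x i) := fun i => rfl
      rw [map_sum, Finset.sum_congr rfl (fun i _ => this i), ← map_sum]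
      congr 1
      ext j
      simp [Finset.sum_apply, Pi.single_apply]
    rw [ht, map_zero] at hΦ
    exact (QuotientAddGroup.eq_zero_iff _).1 hΦ.symm
  clear hrx
  refine AddSubgroup.closure_induction
    (p := fun x _ => ∃ (ι : Type) (_ : Fintype ι) (a : κ → ι → R) (y : ι → M),
      (∀ j, ∑ i, r i * a i j = 0) ∧ ∀ i, x i = ∑ j, a i j • y j) ?_ ?_ ?_ ?_ hS
  · rintro z ⟨a, m, ha, rfl⟩
    exact ⟨Unit, inferInstance, fun i _ => a i, fun _ => m, fun _ => ha, fun i => by simp⟩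
  · exact ⟨Empty, inferInstance, fun _ j => j.elim, fun j => j.elim, fun j => j.elim,
      fun i => by simp⟩
  · rintro z w _ _ ⟨ι, _, a, y, h1, h2⟩ ⟨ι', _, a', y', h1', h2'⟩
    refine ⟨ι ⊕ ι', inferInstance, fun i => Sum.elim (a i) (a' i), Sum.elim y y', ?_, ?_⟩
    · rintro (j | j)
      · exact h1 j
      · exact h1' j
    · intro i
      simp [h2, h2']
  · rintro z _ ⟨ι, _, a, y, h1, h2⟩
    exact ⟨ι, inferInstance, a, fun j => - y j, h1, fun i => by simp [h2]⟩

theorem flat_factor_one {M : Type u} [AddCommGroup M] [Module R M] (hM : FlatMod R M)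
    {κ : Type} [Fintype κ] (f : (κ → R) →ₗ[R] M) (g : κ → R) (hg : f g = 0) :
    ∃ (ι : Type) (_ : Fintype ι) (h : (κ → R) →ₗ[R] (ι → R)) (y : (ι → R) →ₗ[R] M),
      (∀ v, y (h v) = f v) ∧ h g = 0 := by
  classical
  have hf : ∀ v : κ → R, f v = ∑ i, v i • f (Pi.single i 1) := fun v => by
    conv_lhs => rw [pi_eq_sum_univ' v]
    simp [map_sum, Pi.single_apply, ← Pi.single_apply]
  obtain ⟨ι, _, a, y, h1, h2⟩ := flat_equational hM g (fun i => f (Pi.single i 1))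
    (by rw [← hf, hg])
  refine ⟨ι, inferInstance, Fintype.linearCombination R a, Fintype.linearCombination R y, ?_, ?_⟩
  · intro v
    rw [hf v]
    simp only [Fintype.linearCombination_apply, h2, map_sum, map_smul, Finset.sum_apply,
      Pi.smul_apply, Finset.smul_sum, Finset.sum_smul, smul_smul, smul_eq_mul]
  · ext j
    simpa [Fintype.linearCombination_apply] using h1 j

theorem flat_factor {M : Type u} [AddCommGroup M] [Module R M] (hM : FlatMod R M)
    {κ : Type} [Fintype κ] (f : (κ → R) →ₗ[R] M) (s : Finset (κ → R)) :
    (∀ g ∈ s, f g = 0) →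
    ∃ (ι : Type) (_ : Fintype ι) (h : (κ → R) →ₗ[R] (ι → R)) (y : (ι → R) →ₗ[R] M),
      (∀ v, y (h v) = f v) ∧ ∀ g ∈ s, h g = 0 := by
  classical
  induction s using Finset.induction_on with
  | empty => exact fun _ => ⟨κ, inferInstance, LinearMap.id, f, fun _ => rfl, by simp⟩
  | insert a s ha ih =>
    intro hs
    obtain ⟨ι, _, h, y, h1, h2⟩ := ih (fun g hg => hs g (Finset.mem_insert_of_mem hg))
    obtain ⟨ι', _, h', y', h1', h2'⟩ := flat_factor_one hM y (h a)
      (by rw [h1]; exact hs a (Finset.mem_insert_self _ _))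
    refine ⟨ι', inferInstance, h' ∘ₗ h, y', fun v => by simp [h1', h1], ?_⟩
    intro g hg
    rcases Finset.mem_insert.1 hg with rfl | hg
    · exact h2'
    · simp [h2 g hg]

theorem projective_of_flat_fp {M : Type u} [AddCommGroup M] [Module R M] (hM : FlatMod R M)
    (hfp : FinNPres R 1 M) : Module.Projective R M := by
  obtain ⟨k, f, hf, hk⟩ := hfp
  have hk : Module.Finite R (LinearMap.ker f) := hk
  obtain ⟨s, hs⟩ := Module.Finite.iff_fg.1 hk
  obtain ⟨ι, _, h, y, h1, h2⟩ := flat_factor hM f s (fun g hg => by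
    have : g ∈ LinearMap.ker f := hs ▸ Submodule.subset_span hg
    exact this)
  have hle : LinearMap.ker f ≤ LinearMap.ker h := by
    rw [← hs, Submodule.span_le]
    exact fun g hg => h2 g hg
  let σ : M →ₗ[R] (ι → R) :=
    (LinearMap.ker f).liftQ h hle ∘ₗ (f.quotKerEquivOfSurjective hf).symm.toLinearMap
  have hσ : ∀ v, σ (f v) = h v := fun v => by
    have : (f.quotKerEquivOfSurjective hf).symm (f v) = Submodule.Quotient.mk v := by
      rw [LinearEquiv.symm_apply_eq]
      rfl
    simp only [σ, LinearMap.comp_apply, LinearEquiv.coe_coe, this]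
    exact Submodule.liftQ_apply _ _ _
  refine Module.Projective.of_split σ y (LinearMap.ext fun m => ?_)
  obtain ⟨v, rfl⟩ := hf m
  simp [hσ, h1]

theorem projDim_of_flatDim (d : ℕ) : ∀ (M : Type u) [AddCommGroup M] [Module R M],
    FinNPres R (d+1) M → FlatDimLE R d M → ProjDimLE R d M := by
  induction d with
  | zero => intro M _ _ h1 h2; exact projective_of_flat_fp h2 h1
  | succ d ih =>
    rintro M _ _ ⟨k, f, hf, hk⟩ h2
    have h3 := (flatDimLE_iff d _).2 (GDim.syzygy goodFlat d M ((flatDimLE_iff _ _).1 h2) _ _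
      (finFree R k) f hf)
    exact (projDimLE_iff _ _).2 (GDim.cover goodProj d M _ _ (finFree R k) f hf
      ((projDimLE_iff _ _).1 (ih _ hk h3)))

theorem syzygy_projDim' (d : ℕ∞) (hd : 1 ≤ d) (M : Type u) [AddCommGroup M] [Module R M]
    (h : ProjDimLE' R d M) (k : ℕ) (f : (Fin k → R) →ₗ[R] M) (hf : Function.Surjective f) :
    ProjDimLE' R d (LinearMap.ker f) := by
  rintro e rfl
  have h := h e rfl
  obtain _ | e := e
  · simp at hd
  · exact (projDimLE_iff _ _).2 (projDim_succ _ _ (GDim.syzygy goodProj e M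
      ((projDimLE_iff _ _).1 h) _ _ (finFree R k) f hf))

theorem finNPres_all (n : ℕ) (d : ℕ∞) (hd : 1 ≤ d) (hcoh : NDCohRing R n d) (m : ℕ) :
    ∀ (M : Type u) [AddCommGroup M] [Module R M], FinNPres R n M → ProjDimLE' R d M →
      FinNPres R m M := by
  induction m with
  | zero =>
    intro M _ _ h1 h2
    obtain ⟨k, f, hf, _⟩ := hcoh M h1 h2
    exact Module.Finite.of_surjective f hf
  | succ m ih =>
    intro M _ _ h1 h2
    obtain ⟨k, f, hf, hk⟩ := hcoh M h1 h2
    exact ⟨k, f, hf, ih _ hk (syzygy_projDim' d hd M h2 k f hf)⟩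

end Equational

/-- If `R` is left `(n,d)`-coherent, then `FPₙ^{≤d}(R) = FP_∞(R) ∩ F^{≤d}(R)`: the finitely
`n`-presented modules of projective dimension at most `d` are exactly the finitely
`∞`-presented modules of flat dimension at most `d`. -/
theorem fp_n_le_d_eq_fp_infty_inter_flat (R : Type u) [Ring R] (n : ℕ) (hn : 1 ≤ n)
    (d : ℕ∞) (hd : 1 ≤ d) (hcoh : NDCohRing R n d) :
    ∀ (M : Type u) [AddCommGroup M] [Module R M],
      (FinNPres R n M ∧ ProjDimLE' R d M) ↔
        ((∀ k : ℕ, FinNPres R k M) ∧ FlatDimLE' R d M) := by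
  intro M _ _
  constructor
  · rintro ⟨h1, h2⟩
    exact ⟨fun k => finNPres_all n d hd hcoh k M h1 h2,
      fun k hk => flatDim_of_projDim k M (h2 k hk)⟩
  · rintro ⟨h1, h2⟩
    exact ⟨h1 n, fun k hk => projDim_of_flatDim k M (h1 (k+1)) (h2 k hk)⟩
end

section
/- Let R be a ring, n ≥ 1, d ≥ 1 finite. Then FP_n^{≤d}(R) equals the class of finitely generated projective R-modules if and only if R is left (n,d)-coherent and the left annihilator of every finitely generated proper right ideal of R is nonzero. -/
universe u

open CategoryTheory in
theorem projDimLE_iff_cat (R : Type u) [Ring R] (d : ℕ) :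
    ∀ (M : Type u) [AddCommGroup M] [Module R M],
      ProjDimLE R d M ↔ HasProjectiveDimensionLT (ModuleCat.of R M) (d + 1) := by
  induction d with
  | zero =>
    intro M _ _
    rw [zero_add, ← projective_iff_hasProjectiveDimensionLT_one, ← IsProjective.iff_projective]
    rfl
  | succ d ih =>
    intro M _ _
    constructor
    · rintro ⟨ι, f, hf, hk⟩
      have hP : Projective (ModuleCat.of R (ι →₀ R)) :=
        (IsProjective.iff_projective (R := R) (ι →₀ R)).1 inferInstance
      exact ((LinearMap.shortExact_shortComplexKer hf).hasProjectiveDimensionLT_X₃_iff d hP).2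
        ((ih _).1 hk)
    · intro h
      have hf : Function.Surjective (Finsupp.linearCombination R (id : M → M)) :=
        Finsupp.linearCombination_id_surjective R M
      have hP : Projective (ModuleCat.of R (M →₀ R)) :=
        (IsProjective.iff_projective (R := R) (M →₀ R)).1 inferInstance
      exact ⟨M, _, hf, (ih _).2
        (((LinearMap.shortExact_shortComplexKer hf).hasProjectiveDimensionLT_X₃_iff d hP).1 h)⟩

open CategoryTheory in
theorem projDimLE_mono (R : Type u) [Ring R] {d e : ℕ} (h : d ≤ e)
    (M : Type u) [AddCommGroup M] [Module R M] (hM : ProjDimLE R d M) : ProjDimLE R e M := by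
  rw [projDimLE_iff_cat] at *
  exact hasProjectiveDimensionLT_of_ge _ (d + 1) (e + 1) (by omega)

open CategoryTheory in
theorem projDimLE_ker_iff (R : Type u) [Ring R] {d : ℕ}
    (M : Type u) [AddCommGroup M] [Module R M]
    (P : Type u) [AddCommGroup P] [Module R P] [Module.Projective R P]
    (f : P →ₗ[R] M) (hf : Function.Surjective f) :
    ProjDimLE R (d + 1) M ↔ ProjDimLE R d (LinearMap.ker f) := by
  rw [projDimLE_iff_cat, projDimLE_iff_cat]
  have hP : Projective (ModuleCat.of R P) :=
    (IsProjective.iff_projective (R := R) P).1 inferInstance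
  exact (LinearMap.shortExact_shortComplexKer hf).hasProjectiveDimensionLT_X₃_iff d hP

theorem finNPres_finite (R : Type u) [Ring R] (n : ℕ) (M : Type u) [AddCommGroup M] [Module R M]
    (h : FinNPres R n M) : Module.Finite R M := by
  cases n with
  | zero => exact h
  | succ n =>
    obtain ⟨k, f, hf, -⟩ := h
    exact Module.Finite.of_surjective f hf

/-- Kernel retraction equivalent to section. -/
theorem ker_retract_iff {R : Type*} [Ring R] {M P : Type*} [AddCommGroup M] [Module R M]
    [AddCommGroup P] [Module R P] (f : P →ₗ[R] M) (hf : Function.Surjective f) :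
    (∃ l : M →ₗ[R] P, f ∘ₗ l = LinearMap.id) ↔
      (∃ l : P →ₗ[R] LinearMap.ker f, l ∘ₗ (LinearMap.ker f).subtype = LinearMap.id) :=
  ((LinearMap.exact_subtype_ker_map f).split_tfae (Submodule.subtype_injective _) hf).out 0 1

theorem finNPres_of_proj (R : Type u) [Ring R] (n : ℕ) :
    ∀ (M : Type u) [AddCommGroup M] [Module R M], Module.Finite R M → Module.Projective R M →
      FinNPres R n M := by
  induction n with
  | zero => intro M _ _ h _; exact h
  | succ n ih =>
    intro M _ _ h1 h2
    obtain ⟨k, f, hf⟩ := Module.Finite.exists_fin' R M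
    obtain ⟨l, hl⟩ := (ker_retract_iff f hf).1 (Module.projective_lifting_property f _ hf)
    have hs : Function.Surjective l := fun x => ⟨x, LinearMap.congr_fun hl x⟩
    exact ⟨k, f, hf, ih _ (Module.Finite.of_surjective l hs) (Module.Projective.of_split _ l hl)⟩

/-- Every embedding of `A` into a finite free module splits. -/
def SplitsEmb (R : Type u) [Ring R] (A : Type u) [AddCommGroup A] [Module R A] : Prop :=
  ∀ (ι : Type) [Fintype ι] (g : A →ₗ[R] (ι → R)), Function.Injective g →
    ∃ r : (ι → R) →ₗ[R] A, ∀ a, r (g a) = a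

theorem SplitsEmb.prod {R : Type u} [Ring R] {A B : Type u} [AddCommGroup A] [Module R A]
    [AddCommGroup B] [Module R B] (hA : SplitsEmb R A) (hB : SplitsEmb R B) :
    SplitsEmb R (A × B) := by
  intro ι _ g hg
  let g1 := g ∘ₗ LinearMap.inl R A B
  let g2 := g ∘ₗ LinearMap.inr R A B
  have hg12 : ∀ a b, g (a, b) = g1 a + g2 b := by
    intro a b
    simp [g1, g2, ← map_add]
  obtain ⟨r, hr⟩ := hA ι g1 (hg.comp LinearMap.inl_injective)
  let e : (ι → R) →ₗ[R] (ι → R) := LinearMap.id - g1 ∘ₗ r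
  have he : ∀ v, e v = v - g1 (r v) := fun v => rfl
  have hh : Function.Injective (e ∘ₗ g2) := by
    rw [injective_iff_map_eq_zero]
    intro b hb
    have h1 : g (-(r (g2 b)), b) = 0 := by
      rw [hg12, map_neg, neg_add_eq_sub]
      exact hb
    have h2 := (injective_iff_map_eq_zero g).1 hg _ h1
    exact (Prod.mk.inj h2).2
  obtain ⟨φ, hφ⟩ := hB ι (e ∘ₗ g2) hh
  refine ⟨(r ∘ₗ (LinearMap.id - g2 ∘ₗ φ ∘ₗ e)).prod (φ ∘ₗ e), ?_⟩
  rintro ⟨a, b⟩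
  have h1 : φ (e (g (a, b))) = b := by
    have : e (g1 a) = 0 := by rw [he, hr, sub_self]
    rw [hg12, map_add, this, zero_add]
    exact hφ b
  have h2 : r (g (a, b) - g2 (φ (e (g (a, b))))) = a := by
    rw [h1, hg12, add_sub_cancel_right, hr]
  exact Prod.ext h2 h1

theorem SplitsEmb.of_equiv {R : Type u} [Ring R] {A B : Type u} [AddCommGroup A] [Module R A]
    [AddCommGroup B] [Module R B] (e : A ≃ₗ[R] B) (hA : SplitsEmb R A) : SplitsEmb R B := by
  intro ι _ g hg
  obtain ⟨r, hr⟩ := hA ι (g ∘ₗ e.toLinearMap) (hg.comp e.injective)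
  refine ⟨e.toLinearMap ∘ₗ r, fun b => ?_⟩
  have := hr (e.symm b)
  simp at this
  simp [this]

theorem splitsEmb_ring {R : Type u} [Ring R]
    (H : ∀ (I : Submodule Rᵐᵒᵖ R), I.FG → I ≠ ⊤ → ∃ a : R, a ≠ 0 ∧ ∀ x ∈ I, a * x = 0) :
    SplitsEmb R R := by
  intro ι _ g hg
  let I : Submodule Rᵐᵒᵖ R := Submodule.span Rᵐᵒᵖ (Set.range (g 1))
  have hI : I = ⊤ := by
    by_contra hne
    obtain ⟨a, ha, hax⟩ := H I (Submodule.fg_span (Set.finite_range _)) hne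
    apply ha
    apply (injective_iff_map_eq_zero g).1 hg
    have : g a = a • g 1 := by rw [← map_smul, smul_eq_mul, mul_one]
    rw [this]
    ext i
    exact hax _ (Submodule.subset_span ⟨i, rfl⟩)
  have h1 : (1 : R) ∈ I := hI ▸ Submodule.mem_top
  obtain ⟨c, hc⟩ := (Submodule.mem_span_range_iff_exists_fun _).1 h1
  refine ⟨∑ i, (LinearMap.toSpanSingleton R R (c i).unop) ∘ₗ LinearMap.proj i, fun a => ?_⟩
  have : g a = a • g 1 := by rw [← map_smul, smul_eq_mul, mul_one]
  rw [this, map_smul]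
  have h2 : (∑ i, (LinearMap.toSpanSingleton R R (c i).unop) ∘ₗ LinearMap.proj i : (ι → R) →ₗ[R] R)
      (g 1) = 1 := by
    refine Eq.trans ?_ hc
    simp [LinearMap.sum_apply, MulOpposite.smul_eq_mul_unop]
  rw [h2, smul_eq_mul, mul_one]

theorem splitsEmb_pi {R : Type u} [Ring R] (hR : SplitsEmb R R) (m : ℕ) :
    SplitsEmb R (Fin m → R) := by
  induction m with
  | zero => exact fun ι _ g hg => ⟨0, fun a => Subsingleton.elim _ _⟩
  | succ m ih => exact (hR.prod ih).of_equiv (Fin.consLinearEquiv R (fun _ : Fin (m + 1) => R))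

theorem splitsEmb_proj {R : Type u} [Ring R] (hR : SplitsEmb R R) (K : Type u) [AddCommGroup K]
    [Module R K] [Module.Finite R K] [Module.Projective R K] : SplitsEmb R K := by
  intro ι _ g hg
  obtain ⟨m, p, hp⟩ := Module.Finite.exists_fin' R K
  obtain ⟨s, hs⟩ := Module.projective_lifting_property p LinearMap.id hp
  have hs' : ∀ y, p (s y) = y := fun y => LinearMap.congr_fun hs y
  let e := LinearEquiv.sumArrowLequivProdArrow ι (Fin m) R R
  let g' : (Fin m → R) →ₗ[R] (ι → R) × (Fin m → R) :=
    (g ∘ₗ p).prod (LinearMap.id - s ∘ₗ p)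
  have hg' : Function.Injective g' := by
    rw [injective_iff_map_eq_zero]
    intro x hx
    have h1 : g (p x) = 0 := (Prod.mk.inj hx).1
    have h2 : x - s (p x) = 0 := (Prod.mk.inj hx).2
    have h3 := (injective_iff_map_eq_zero g).1 hg _ h1
    rwa [h3, map_zero, sub_zero] at h2
  obtain ⟨r, hr⟩ := splitsEmb_pi hR m (ι ⊕ Fin m) (e.symm.toLinearMap ∘ₗ g')
    (e.symm.injective.comp hg')
  refine ⟨p ∘ₗ r ∘ₗ e.symm.toLinearMap ∘ₗ LinearMap.inl R _ _, fun y => ?_⟩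
  have h1 : g' (s y) = (g y, 0) := by
    change (g (p (s y)), s y - s (p (s y))) = _
    rw [hs', sub_self]
  have h2 := hr (s y)
  change r (e.symm (g' (s y))) = _ at h2
  rw [h1] at h2
  change p (r (e.symm (g y, 0))) = y
  rw [h2, hs']

theorem proj_of_coh {R : Type u} [Ring R] (n d : ℕ) (hc : NDCohRing R n (d : ℕ∞))
    (hR : SplitsEmb R R) (j : ℕ) : j ≤ d → 
    ∀ (M : Type u) [AddCommGroup M] [Module R M], FinNPres R n M → ProjDimLE R j M →
      Module.Projective R M := by
  induction j with
  | zero => intro _ M _ _ _ h; exact h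
  | succ j ih =>
    intro hj M _ _ h1 h2
    obtain ⟨k, f, hf, hk⟩ := hc M h1 (fun i hi => by
      have : i = d := by exact_mod_cast hi
      exact projDimLE_mono R (by omega) M h2)
    have hK := ih (by omega) _ hk ((projDimLE_ker_iff R M _ f hf).1 h2)
    have hKf := finNPres_finite R n _ hk
    obtain ⟨r, hr⟩ := splitsEmb_proj hR (LinearMap.ker f) (Fin k) (LinearMap.ker f).subtype
      (Submodule.subtype_injective _)
    obtain ⟨l, hl⟩ := (ker_retract_iff f hf).2 ⟨r, LinearMap.ext hr⟩
    exact Module.Projective.of_split l f hl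

theorem ann_of_proj {R : Type u} [Ring R] (n d : ℕ) (hd : 1 ≤ d)
    (H : ∀ (M : Type u) [AddCommGroup M] [Module R M],
        FinNPres R n M → ProjDimLE R d M → Module.Projective R M)
    (hn : 1 ≤ n)
    (I : Submodule Rᵐᵒᵖ R) (hI : I.FG) (hne : I ≠ ⊤) : ∃ a : R, a ≠ 0 ∧ ∀ x ∈ I, a * x = 0 := by
  by_contra! hcon
  apply hne
  obtain ⟨m, x, hx⟩ := Submodule.fg_iff_exists_fin_generating_family.1 hI
  let g : R →ₗ[R] (Fin m → R) := LinearMap.toSpanSingleton R _ x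
  have hg : Function.Injective g := by
    rw [injective_iff_map_eq_zero]
    intro a ha
    by_contra hne
    obtain ⟨y, hy, hay⟩ := hcon a hne
    apply hay
    rw [← hx] at hy
    obtain ⟨c, rfl⟩ := (Submodule.mem_span_range_iff_exists_fun _).1 hy
    rw [Finset.mul_sum]
    refine Finset.sum_eq_zero fun i _ => ?_
    have : a * x i = 0 := congrFun ha i
    rw [MulOpposite.smul_eq_mul_unop, ← mul_assoc, this, zero_mul]
  let q := (LinearMap.range g).mkQ
  have hq : Function.Surjective q := Submodule.mkQ_surjective _
  have hker : LinearMap.ker q = LinearMap.range g := Submodule.ker_mkQ _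
  let e : R ≃ₗ[R] LinearMap.ker q :=
    (LinearEquiv.ofInjective g hg).trans (LinearEquiv.ofEq _ _ hker.symm)
  have hp : Module.Projective R (LinearMap.ker q) := Module.Projective.of_equiv e
  have hfin : Module.Finite R (LinearMap.ker q) := Module.Finite.equiv e
  obtain ⟨d, rfl⟩ := Nat.exists_eq_add_of_le' hd
  obtain ⟨n, rfl⟩ := Nat.exists_eq_add_of_le' hn
  have hM := H ((Fin m → R) ⧸ LinearMap.range g)
    ⟨m, q, hq, finNPres_of_proj R n _ hfin hp⟩
    ((projDimLE_ker_iff R _ _ q hq).2 (projDimLE_mono R (Nat.zero_le d) _ hp))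
  obtain ⟨l, hl⟩ := (ker_retract_iff q hq).1 (Module.projective_lifting_property q _ hq)
  let φ : (Fin m → R) →ₗ[R] R := e.symm.toLinearMap ∘ₗ l
  have hφ : φ x = 1 := by
    have h1 : ((e 1 : LinearMap.ker q) : Fin m → R) = x := by
      change g 1 = x
      simp [g]
    have h2 : l ((e 1 : LinearMap.ker q) : Fin m → R) = e 1 := LinearMap.congr_fun hl (e 1)
    rw [h1] at h2
    change e.symm (l x) = 1
    rw [h2, e.symm_apply_apply]
  have h1 : (1 : R) ∈ I := by
    rw [← hφ, ← hx, pi_eq_sum_univ x, map_sum]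
    refine Submodule.sum_mem _ fun i _ => ?_
    rw [map_smul, smul_eq_mul, ← op_smul_eq_mul]
    exact Submodule.smul_mem _ _ (Submodule.subset_span ⟨i, by simp⟩)
  rw [eq_top_iff]
  intro y _
  have := I.smul_mem (MulOpposite.op y) h1
  simpa using this

/-- `FPₙ^{≤d}(R)` equals the class of finitely generated projective modules if and only if
`R` is left `(n,d)`-coherent and the left annihilator of every finitely generated proper
right ideal of `R` is nonzero. -/
theorem fp_n_le_d_eq_proj_iff (R : Type u) [Ring R] (n : ℕ) (hn : 1 ≤ n) (d : ℕ) (hd : 1 ≤ d) :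
    (∀ (M : Type u) [AddCommGroup M] [Module R M],
        (FinNPres R n M ∧ ProjDimLE R d M) ↔ (Module.Finite R M ∧ Module.Projective R M)) ↔
      (NDCohRing R n (d : ℕ∞) ∧
        ∀ (I : Submodule Rᵐᵒᵖ R), I.FG → I ≠ ⊤ →
          ∃ a : R, a ≠ 0 ∧ ∀ x ∈ I, a * x = 0) := by
  constructor
  · intro H
    refine ⟨fun M _ _ h1 h2 => ?_, fun I hI hne => ann_of_proj n d hd
      (fun M _ _ h1 h2 => ((H M).1 ⟨h1, h2⟩).2) hn I hI hne⟩
    have h3 := (H M).1 ⟨h1, h2 d rfl⟩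
    exact finNPres_of_proj R (n + 1) M h3.1 h3.2
  · rintro ⟨hc, hann⟩ M _ _
    constructor
    · rintro ⟨h1, h2⟩
      exact ⟨finNPres_finite R n M h1,
        proj_of_coh n d hc (splitsEmb_ring hann) d le_rfl M h1 h2⟩
    · rintro ⟨h1, h2⟩
      exact ⟨finNPres_of_proj R n M h1 h2, projDimLE_mono R (Nat.zero_le d) M h2⟩
end

section
/- Let R be a commutative ring, n ≥ 2, and let S be a multiplicative subset of R. If M is a finitely n-presented R-module and N is any R-module, then there is a natural isomorphism Ext^1_R(M,N)_S ≅ Ext^1_{R_S}(M_S, N_S) between the localization of Ext^1 and Ext^1 over the localized ring. -/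
universe u

/-- The first syzygy of `M` with respect to the canonical free cover `(M →₀ R) ↠ M`. -/
noncomputable abbrev Syz (R : Type u) [CommRing R] (M : Type u) [AddCommGroup M]
    [Module R M] : Submodule R (M →₀ R) :=
  LinearMap.ker (Finsupp.linearCombination R (_root_.id : M → M))

/-- `Ext¹_R(M, N)`, computed as the cokernel of
`Hom_R(M →₀ R, N) → Hom_R(Syz R M, N)` for the canonical free presentation of `M`. -/
noncomputable abbrev ExtOne (R : Type u) [CommRing R] (M N : Type u) [AddCommGroup M]
    [Module R M] [AddCommGroup N] [Module R N] : Type u :=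
  ((Syz R M →ₗ[R] N)) ⧸ LinearMap.range (LinearMap.lcomp R N (Syz R M).subtype)

/-- Factor a map through the kernel of an exact pair. -/
theorem exists_factor_of_exact {R : Type*} [CommRing R] {K F M P : Type*} [AddCommGroup K]
    [Module R K] [AddCommGroup F] [Module R F] [AddCommGroup M] [Module R M] [AddCommGroup P]
    [Module R P] (i : K →ₗ[R] F) (f : F →ₗ[R] M) (hi : Function.Injective i)
    (hif : Function.Exact i f) (h : P →ₗ[R] F) (hh : f ∘ₗ h = 0) :
    ∃ s : P →ₗ[R] K, i ∘ₗ s = h := by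
  have hr : ∀ x, h x ∈ LinearMap.range i := fun x =>
    (hif (h x)).1 (LinearMap.congr_fun hh x)
  refine ⟨(LinearEquiv.ofInjective i hi).symm.toLinearMap ∘ₗ h.codRestrict _ hr, ?_⟩
  ext x
  have := (LinearEquiv.ofInjective i hi).apply_symm_apply (h.codRestrict _ hr x)
  simpa using congrArg Subtype.val this

/-- Independence of the projective presentation: one half of the homotopy argument. -/
theorem ext_homotopy {R : Type*} [CommRing R] {K F M N : Type*} [AddCommGroup K]
    [Module R K] [AddCommGroup F] [Module R F] [AddCommGroup M] [Module R M] [AddCommGroup N]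
    [Module R N] (i : K →ₗ[R] F) (f : F →ₗ[R] M) (hi : Function.Injective i)
    (hif : Function.Exact i f) (χ : F →ₗ[R] F) (γ : K →ₗ[R] K) (hχ : f ∘ₗ χ = f)
    (hγ : i ∘ₗ γ = χ ∘ₗ i) (g : K →ₗ[R] N) :
    g ∘ₗ γ - g ∈ LinearMap.range (LinearMap.lcomp R N i) := by
  obtain ⟨s, hs⟩ := exists_factor_of_exact i f hi hif (χ - LinearMap.id)
    (by rw [LinearMap.comp_sub, hχ, LinearMap.comp_id, sub_self])
  refine ⟨g ∘ₗ s, ?_⟩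
  ext x
  have h1 : s (i x) = γ x - x := by
    apply hi
    have h2 := LinearMap.congr_fun hs (i x)
    have h3 := LinearMap.congr_fun hγ x
    simp only [LinearMap.comp_apply, LinearMap.sub_apply, LinearMap.id_apply] at h2 h3
    rw [h2, map_sub, h3]
  simp [h1]

/-- `Ext¹` does not depend on the projective presentation. -/
theorem ext_indep {R : Type*} [CommRing R] {K F K' F' M N : Type*} [AddCommGroup K]
    [Module R K] [AddCommGroup F] [Module R F] [AddCommGroup K']
    [Module R K'] [AddCommGroup F'] [Module R F']
    [AddCommGroup M] [Module R M] [AddCommGroup N] [Module R N]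
    [Module.Projective R F] [Module.Projective R F']
    (i : K →ₗ[R] F) (f : F →ₗ[R] M) (hi : Function.Injective i)
    (hif : Function.Exact i f) (hf : Function.Surjective f)
    (i' : K' →ₗ[R] F') (f' : F' →ₗ[R] M) (hi' : Function.Injective i')
    (hif' : Function.Exact i' f') (hf' : Function.Surjective f') :
    Nonempty (((K →ₗ[R] N) ⧸ LinearMap.range (LinearMap.lcomp R N i)) ≃ₗ[R]
      ((K' →ₗ[R] N) ⧸ LinearMap.range (LinearMap.lcomp R N i'))) := by
  obtain ⟨φ, hφ⟩ := Module.projective_lifting_property f' f hf'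
  obtain ⟨ψ, hψ⟩ := Module.projective_lifting_property f f' hf
  obtain ⟨α, hα⟩ := exists_factor_of_exact i' f' hi' hif' (φ ∘ₗ i)
    (by rw [← LinearMap.comp_assoc, hφ]; exact hif.linearMap_comp_eq_zero)
  obtain ⟨β, hβ⟩ := exists_factor_of_exact i f hi hif (ψ ∘ₗ i')
    (by rw [← LinearMap.comp_assoc, hψ]; exact hif'.linearMap_comp_eq_zero)
  refine ⟨LinearEquiv.ofLinearMap
    (Submodule.mapQ _ _ (LinearMap.lcomp R N β) ?_)
    (Submodule.mapQ _ _ (LinearMap.lcomp R N α) ?_) ?_ ?_⟩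
  · rintro _ ⟨g, rfl⟩
    refine ⟨g ∘ₗ ψ, ?_⟩
    change (g ∘ₗ ψ) ∘ₗ i' = (g ∘ₗ i) ∘ₗ β
    rw [LinearMap.comp_assoc, LinearMap.comp_assoc, hβ]
  · rintro _ ⟨g, rfl⟩
    refine ⟨g ∘ₗ φ, ?_⟩
    change (g ∘ₗ φ) ∘ₗ i = (g ∘ₗ i') ∘ₗ α
    rw [LinearMap.comp_assoc, LinearMap.comp_assoc, hα]
  · apply Submodule.linearMap_qext
    apply LinearMap.ext
    intro g
    refine (Submodule.Quotient.eq _).2 ?_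
    refine ext_homotopy i' f' hi' hif' (φ ∘ₗ ψ) (α ∘ₗ β) ?_ ?_ g
    · rw [← LinearMap.comp_assoc, hφ, hψ]
    · rw [← LinearMap.comp_assoc, hα, LinearMap.comp_assoc, hβ, LinearMap.comp_assoc]
  · apply Submodule.linearMap_qext
    apply LinearMap.ext
    intro g
    refine (Submodule.Quotient.eq _).2 ?_
    refine ext_homotopy i f hi hif (ψ ∘ₗ φ) (β ∘ₗ α) ?_ ?_ g
    · rw [← LinearMap.comp_assoc, hψ, hφ]
    · rw [← LinearMap.comp_assoc, hβ, LinearMap.comp_assoc, hα, LinearMap.comp_assoc]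

/-- Localization of the cokernel of `Hom(F, N) → Hom(K, N)`. -/
theorem coker_localization {R : Type u} [CommRing R] (S : Submonoid R)
    {K F : Type u} (N : Type u) [AddCommGroup K] [Module R K] [AddCommGroup F] [Module R F]
    [AddCommGroup N] [Module R N] [Module.FinitePresentation R K]
    [Module.FinitePresentation R F] (i : K →ₗ[R] F) :
    Nonempty (LocalizedModule S ((K →ₗ[R] N) ⧸ LinearMap.range (LinearMap.lcomp R N i))
      ≃ₗ[Localization S]
      ((LocalizedModule S K →ₗ[Localization S] LocalizedModule S N) ⧸
        LinearMap.range (LinearMap.lcomp (Localization S) (LocalizedModule S N)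
          (LocalizedModule.map S i)))) := by
  let hK := IsLocalizedModule.mapExtendScalars S (LocalizedModule.mkLinearMap S K)
    (LocalizedModule.mkLinearMap S N) (Localization S)
  let hF := IsLocalizedModule.mapExtendScalars S (LocalizedModule.mkLinearMap S F)
    (LocalizedModule.mkLinearMap S N) (Localization S)
  have key : (LinearMap.range (LinearMap.lcomp R N i)).localized' (Localization S) S hK =
      LinearMap.range (LinearMap.lcomp (Localization S) (LocalizedModule S N)
          (LocalizedModule.map S i)) := by
    rw [LinearMap.localized'_range_eq_range_localizedMap (Localization S) S hF hK]
    congr 1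
    apply LinearMap.restrictScalars_injective R
    apply IsLocalizedModule.linearMap_ext S hF hK
    apply LinearMap.ext
    intro g
    change IsLocalizedModule.map S hF hK (LinearMap.lcomp R N i) (hF g) =
      (hF g) ∘ₗ (LocalizedModule.map S i)
    rw [IsLocalizedModule.map_apply]
    apply LinearMap.restrictScalars_injective R
    apply IsLocalizedModule.linearMap_ext S (LocalizedModule.mkLinearMap S K)
      (LocalizedModule.mkLinearMap S N)
    ext x
    change IsLocalizedModule.map S (LocalizedModule.mkLinearMap S K)
        (LocalizedModule.mkLinearMap S N) (g ∘ₗ i) (LocalizedModule.mkLinearMap S K x) =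
      IsLocalizedModule.map S (LocalizedModule.mkLinearMap S F)
        (LocalizedModule.mkLinearMap S N) g
        (IsLocalizedModule.map S (LocalizedModule.mkLinearMap S K)
          (LocalizedModule.mkLinearMap S F) i (LocalizedModule.mkLinearMap S K x))
    rw [IsLocalizedModule.map_apply, IsLocalizedModule.map_apply, IsLocalizedModule.map_apply,
      LinearMap.comp_apply]
  rw [← key]
  exact ⟨(IsLocalizedModule.linearEquiv S (LocalizedModule.mkLinearMap S _)
    (Submodule.toLocalizedQuotient' (Localization S) S hK
      (LinearMap.range (LinearMap.lcomp R N i)))).extendScalarsOfIsLocalization S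
        (Localization S)⟩

/-- A finitely `(n+1)`-presented module is finitely presented. -/
theorem FinNPres.finite {R : Type u} [CommRing R] (n : ℕ) {M : Type u} [AddCommGroup M]
    [Module R M] (h : FinNPres R n M) : Module.Finite R M := by
  cases n with
  | zero => exact h
  | succ n =>
    obtain ⟨k, f, hf, -⟩ := h
    exact Module.Finite.of_surjective f hf

/-- For a commutative ring `R`, `n ≥ 2`, a multiplicative set `S ⊆ R`, a finitely
`n`-presented `R`-module `M` and an arbitrary `R`-module `N`, localization commutes with
`Ext¹`:  `Ext¹_R(M,N)_S ≅ Ext¹_{R_S}(M_S, N_S)`. -/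
theorem extOne_localization (R : Type u) [CommRing R] (n : ℕ) (hn : 2 ≤ n) (S : Submonoid R)
    (M N : Type u) [AddCommGroup M] [Module R M] [AddCommGroup N] [Module R N]
    (hM : FinNPres R n M) :
    Nonempty ((LocalizedModule S (ExtOne R M N)) ≃ₗ[Localization S]
      ExtOne (Localization S) (LocalizedModule S M) (LocalizedModule S N)) := by
  obtain ⟨m, rfl⟩ : ∃ m, n = m + 2 := ⟨n - 2, by omega⟩
  obtain ⟨k, f, hf, l, g, hg, hfin⟩ := hM
  have : Module.Finite R (LinearMap.ker g) := hfin.finite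
  have : Module.FinitePresentation R (LinearMap.ker f) :=
    Module.finitePresentation_of_surjective g hg (Module.Finite.iff_fg.1 this)
  have surjA : ∀ (A : Type u) [CommRing A] (X : Type u) [AddCommGroup X] [Module A X],
      Function.Surjective (Finsupp.linearCombination A (_root_.id : X → X)) := by
    intro A _ X _ _
    exact Finsupp.linearCombination_id_surjective A X
  have exA : ∀ (A : Type u) [CommRing A] (X : Type u) [AddCommGroup X] [Module A X],
      Function.Exact (Syz A X).subtype
        (Finsupp.linearCombination A (_root_.id : X → X)) := by
    intro A _ X _ _
    exact LinearMap.exact_subtype_ker_map (Finsupp.linearCombination A (_root_.id : X → X))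
  have hex : Function.Exact (LinearMap.ker f).subtype f := LinearMap.exact_subtype_ker_map f
  obtain ⟨e1⟩ := ext_indep (K := Syz R M) (F := M →₀ R) (K' := LinearMap.ker f)
    (F' := Fin k → R) (N := N) (Syz R M).subtype
    (Finsupp.linearCombination R (_root_.id : M → M)) (Submodule.subtype_injective _)
    (exA R M) (surjA R M)
    (LinearMap.ker f).subtype f (Submodule.subtype_injective _) hex hf
  obtain ⟨e2⟩ := coker_localization (K := LinearMap.ker f) (F := Fin k → R) S N (LinearMap.ker f).subtype
  obtain ⟨e3⟩ := ext_indep (K := LocalizedModule S (LinearMap.ker f))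
    (F := LocalizedModule S (Fin k → R)) (K' := Syz (Localization S) (LocalizedModule S M))
    (F' := LocalizedModule S M →₀ Localization S) (N := LocalizedModule S N)
    (LocalizedModule.map S (LinearMap.ker f).subtype) (LocalizedModule.map S f)
    (LocalizedModule.map_injective S _ (Submodule.subtype_injective _))
    (LocalizedModule.map_exact S _ _ hex)
    (LocalizedModule.map_surjective S _ hf)
    (Syz (Localization S) (LocalizedModule S M)).subtype
    (Finsupp.linearCombination (Localization S)
      (_root_.id : LocalizedModule S M → LocalizedModule S M)) (Submodule.subtype_injective _)
    (exA (Localization S) (LocalizedModule S M)) (surjA (Localization S) (LocalizedModule S M))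
  exact ⟨((IsLocalizedModule.mapEquiv S (LocalizedModule.mkLinearMap S _)
    (LocalizedModule.mkLinearMap S _) (Localization S) e1).trans e2).trans e3⟩
end
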